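/- arXiv:math/0308156 — 2 statements merged into one kernel-verified Lean document; each statement's English description precedes it below -/
import Mathlib

section
/- Suppose the root system Δ is not simply laced and the fundamental coweight ϖ_i∨ is minuscule for Δ. Then the fundamental weight ϖ_i is minuscule for Δ∨_s, the simply-laced root system consisting of the short vectors of the dual root system Δ∨ (i.e. ⟨ϖ_i, α∨⟩ ∈ {0,1} for every positive short coroot α∨ ∈ Δ∨_s); furthermore the simple coroot α_i∨ is a short vector of Δ∨, i.e. α_i∨ ∈ Δ∨_s. -/
/-
Background: reduced irreducible crystallographic root systems with a chosen base,
realized in a real inner product space.  Coweights are represented as vectors of the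
same space via the `W`-invariant inner product (so the coroot of `a` is `2a/(a,a)`).
-/

open scoped RealInnerProductSpace Classical

noncomputable section

namespace Litt

variable {V : Type*} [NormedAddCommGroup V] [InnerProductSpace ℝ V]

/-- The coroot of a root vector, under the inner-product identification of `𝔥` with `𝔥*`. -/
def coroot (a : V) : V := (2 / ⟪a, a⟫) • a

/-- The pairing `⟨x, α∨⟩` of a weight `x` with the coroot of `a`. -/
def pairc (x a : V) : ℝ := ⟪x, coroot a⟫

/-- The reflection `s_a (x) = x - ⟨x, a∨⟩ a`, as a linear map. -/
def sLin (a : V) : V →ₗ[ℝ] V :=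
  LinearMap.id - ((innerₛₗ ℝ (coroot a)).smulRight a)

/-- A reduced irreducible crystallographic root system spanning `V`, together with a
chosen system of simple roots `α 0, …, α (r-1)`. -/
structure RootSystemBase (r : ℕ) (V : Type*) [NormedAddCommGroup V]
    [InnerProductSpace ℝ V] where
  roots : Set V
  α : Fin r → V
  finite : roots.Finite
  ne_zero : ∀ a ∈ roots, a ≠ 0
  span_top : Submodule.span ℝ roots = ⊤
  reduced : ∀ a ∈ roots, ∀ t : ℝ, t • a ∈ roots → t = 1 ∨ t = -1
  reflect_mem : ∀ a ∈ roots, ∀ b ∈ roots, sLin a b ∈ roots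
  cryst : ∀ a ∈ roots, ∀ b ∈ roots, ∃ n : ℤ, pairc b a = (n : ℝ)
  irred : ∀ S T : Set V, roots = S ∪ T → (∀ a ∈ S, ∀ b ∈ T, ⟪a, b⟫ = 0) →
    S = ∅ ∨ T = ∅
  simple_mem : ∀ i, α i ∈ roots
  simple_indep : LinearIndependent ℝ α
  pos_or_neg : ∀ a ∈ roots, (∃ c : Fin r → ℕ, a = ∑ i, (c i : ℝ) • α i) ∨
    (∃ c : Fin r → ℕ, a = -∑ i, (c i : ℝ) • α i)

namespace RootSystemBase

variable {r : ℕ} (R : RootSystemBase r V)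

/-- The positive roots determined by the base. -/
def pos : Set V := {a ∈ R.roots | ∃ c : Fin r → ℕ, a = ∑ i, (c i : ℝ) • R.α i}

/-- `w` is the fundamental weight at node `i`:  `⟨w, α_j∨⟩ = δ_ij`. -/
def IsFundWeight (i : Fin r) (w : V) : Prop :=
  ∀ j, pairc w (R.α j) = if j = i then 1 else 0

/-- `c` is (the image under `ν` of) the fundamental coweight at node `i`:
`⟨α_j, ϖ_i∨⟩ = δ_ij`, the pairing of a root with a coweight being realized by the
inner product. -/
def IsFundCoweight (i : Fin r) (c : V) : Prop :=
  ∀ j, ⟪R.α j, c⟫ = if j = i then 1 else 0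

/-- A coweight is minuscule if it pairs to `0` or `1` with every positive root. -/
def IsMinusculeCoweight (c : V) : Prop :=
  ∀ a ∈ R.pos, ⟪a, c⟫ = 0 ∨ ⟪a, c⟫ = 1

/-- The Weyl group: the subgroup of `GL(V)` generated by the simple reflections. -/
def weyl : Subgroup (V ≃ₗ[ℝ] V) :=
  Subgroup.closure {g | ∃ i : Fin r, ∀ x, g x = sLin (R.α i) x}

/-- The orbit `W·λ` of a weight under the Weyl group. -/
def orbit (lam : V) : Set V := {x | ∃ g ∈ R.weyl, x = g lam}

/-- `w` is the longest element `w₀` of the Weyl group: it sends every positive root to a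
negative root. -/
def IsLongest (w : V ≃ₗ[ℝ] V) : Prop :=
  w ∈ R.weyl ∧ ∀ a ∈ R.pos, -(w a) ∈ R.pos

/-- `w` is the longest element of the parabolic subgroup `Stab_W(ϖ)`: it stabilizes `ϖ`
and sends every positive root pairing to `0` with `ϖ` to a negative root. -/
def IsLongestPar (ϖ : V) (w : V ≃ₗ[ℝ] V) : Prop :=
  w ∈ R.weyl ∧ w ϖ = ϖ ∧ ∀ a ∈ R.pos, pairc ϖ a = 0 → -(w a) ∈ R.pos

/-- `θ` is the highest root: for every root `a`, `θ - a` is a nonnegative combination of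
the simple roots. -/
def IsHighestRoot (θ : V) : Prop :=
  θ ∈ R.pos ∧ ∀ a ∈ R.roots, ∃ c : Fin r → ℕ, θ - a = ∑ i, (c i : ℝ) • R.α i

/-- The coroot lattice, as a `ℤ`-submodule of `V`. -/
def corootLattice : Submodule ℤ V := Submodule.span ℤ (coroot '' R.roots)

end RootSystemBase

end Litt
namespace Litt

namespace RootSystemBase

variable {V : Type*} [NormedAddCommGroup V] [InnerProductSpace ℝ V] {r : ℕ}

/-- The dual root system `Δ∨` (the set of coroots). -/
def dualRoots (R : RootSystemBase r V) : Set V := coroot '' R.roots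

/-- The set `Δ∨_s` of short vectors of the dual root system (the vectors of minimal
length), which forms a simply-laced root system. -/
def shortDualRoots (R : RootSystemBase r V) : Set V :=
  {x ∈ R.dualRoots | ∀ y ∈ R.dualRoots, ⟪x, x⟫ ≤ ⟪y, y⟫}

end RootSystemBase

section

variable {V : Type*} [NormedAddCommGroup V] [InnerProductSpace ℝ V]

lemma sLin_apply (a x : V) : sLin a x = x - pairc x a • a := by
  simp [sLin, pairc, real_inner_comm]

lemma pairc_eq (x a : V) : pairc x a = 2 / ⟪a, a⟫ * ⟪x, a⟫ := by
  simp [pairc, coroot, real_inner_smul_right]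

lemma pairc_mul_inner_self {a : V} (ha : a ≠ 0) (x : V) : pairc x a * ⟪a, a⟫ = 2 * ⟪x, a⟫ := by
  have := inner_self_ne_zero (𝕜 := ℝ).2 ha
  rw [pairc_eq]
  field_simp

lemma inner_sLin_self {a : V} (ha : a ≠ 0) (x : V) : ⟪sLin a x, sLin a x⟫ = ⟪x, x⟫ := by
  have h := pairc_mul_inner_self ha x
  rw [sLin_apply]
  simp only [inner_sub_left, inner_sub_right, real_inner_smul_left, real_inner_smul_right,
    real_inner_comm x a]
  linear_combination pairc x a * h

lemma inner_coroot_self {a : V} (ha : a ≠ 0) : ⟪coroot a, coroot a⟫ = 4 / ⟪a, a⟫ := by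
  have := inner_self_ne_zero (𝕜 := ℝ).2 ha
  simp only [coroot, real_inner_smul_left, real_inner_smul_right]
  field_simp
  norm_num

lemma inner_coroot_self_le_iff {a b : V} (ha : a ≠ 0) (hb : b ≠ 0) :
    ⟪coroot a, coroot a⟫ ≤ ⟪coroot b, coroot b⟫ ↔ ⟪b, b⟫ ≤ ⟪a, a⟫ := by
  rw [inner_coroot_self ha, inner_coroot_self hb]
  exact div_le_div_iff_of_pos_left (by norm_num) (real_inner_self_pos.2 ha)
    (real_inner_self_pos.2 hb)

namespace RootSystemBase

variable {r : ℕ} (R : RootSystemBase r V)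

lemma coroot_mem_shortDualRoots_iff {a : V} (ha : a ∈ R.roots) :
    coroot a ∈ R.shortDualRoots ↔ ∀ b ∈ R.roots, ⟪b, b⟫ ≤ ⟪a, a⟫ := by
  constructor
  · rintro ⟨-, h⟩ b hb
    exact (inner_coroot_self_le_iff (R.ne_zero a ha) (R.ne_zero b hb)).1 (h _ ⟨b, hb, rfl⟩)
  · refine fun h => ⟨⟨a, ha, rfl⟩, ?_⟩
    rintro _ ⟨b, hb, rfl⟩
    exact (inner_coroot_self_le_iff (R.ne_zero a ha) (R.ne_zero b hb)).2 (h b hb)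

/-- In an irreducible root system, every root is non-orthogonal to some root of each length. -/
lemma exists_inner_self_eq_and_inner_ne_zero {a b : V} (ha : a ∈ R.roots) (hb : b ∈ R.roots) :
    ∃ l ∈ R.roots, ⟪l, l⟫ = ⟪b, b⟫ ∧ ⟪a, l⟫ ≠ 0 := by
  let S : Set V := {s ∈ R.roots | ∀ l ∈ R.roots, ⟪l, l⟫ = ⟪b, b⟫ → ⟪s, l⟫ = 0}
  have hST : ∀ s ∈ S, ∀ t ∈ R.roots \ S, ⟪s, t⟫ = 0 := by
    rintro s ⟨-, hs⟩ t ⟨ht, htS⟩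
    obtain ⟨l, hl, hlb, htl⟩ : ∃ l ∈ R.roots, ⟪l, l⟫ = ⟪b, b⟫ ∧ ⟪t, l⟫ ≠ 0 := by
      by_contra! h
      exact htS ⟨ht, h⟩
    have ht0 := R.ne_zero t ht
    have h := hs _ (R.reflect_mem t ht l hl) ((inner_sLin_self ht0 l).trans hlb)
    rw [sLin_apply, inner_sub_right, real_inner_smul_right, hs l hl hlb, zero_sub,
      neg_eq_zero, mul_eq_zero] at h
    refine h.resolve_left fun h0 => htl ?_
    have := pairc_mul_inner_self ht0 l
    rw [h0] at this
    rw [real_inner_comm]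
    linarith
  have hS : S ⊆ R.roots := fun _ h => h.1
  rcases R.irred S (R.roots \ S) (Set.union_sdiff_cancel hS).symm hST with h | h
  · by_contra! hne
    exact h.subset (⟨ha, hne⟩ : a ∈ S)
  · have hbS : b ∈ S := by
      by_contra hn
      exact h.subset ⟨hb, hn⟩
    exact absurd (hbS.2 b hb rfl) (inner_self_ne_zero (𝕜 := ℝ).2 (R.ne_zero b hb))

lemma exists_pairc_le_neg_two {a b : V} (ha : a ∈ R.roots) (hb : b ∈ R.roots)
    (hab : ⟪a, a⟫ < ⟪b, b⟫) :
    ∃ l ∈ R.roots, ⟪l, l⟫ = ⟪b, b⟫ ∧ pairc l a ≤ -2 := by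
  obtain ⟨l, hl, hlb, hal⟩ := R.exists_inner_self_eq_and_inner_ne_zero ha hb
  have ha0 := R.ne_zero a ha
  obtain ⟨n, hn⟩ := R.cryst a ha l hl
  obtain ⟨m, hm⟩ := R.cryst l hl a ha
  have h1 := pairc_mul_inner_self ha0 l
  have h2 := pairc_mul_inner_self (R.ne_zero l hl) a
  rw [hn, real_inner_comm a l] at h1
  rw [hm, hlb] at h2
  have hpos := real_inner_self_pos.2 ha0
  have hm0 : m ≠ 0 := by
    rintro rfl
    apply hal
    push_cast at h2
    linarith
  have hn2 : n ≤ -2 ∨ 2 ≤ n := by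
    by_contra! hlt
    rcases lt_or_gt_of_ne hm0 with h | h
    · have hm1 : (m : ℝ) ≤ -1 := by exact_mod_cast (show m ≤ -1 by omega)
      have hn1 : (-1 : ℝ) ≤ n := by exact_mod_cast (show -1 ≤ n by omega)
      nlinarith
    · have hm1 : (1 : ℝ) ≤ m := by exact_mod_cast h
      have hn1 : (n : ℝ) ≤ 1 := by exact_mod_cast (show n ≤ 1 by omega)
      nlinarith
  rcases hn2 with h | h
  · exact ⟨l, hl, hlb, by rw [hn]; exact_mod_cast h⟩
  · refine ⟨_, R.reflect_mem a ha l hl, (inner_sLin_self ha0 l).trans hlb, ?_⟩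
    have hn' : (2 : ℝ) ≤ n := by exact_mod_cast h
    have hself : pairc a a = 2 := by
      rw [pairc_eq]
      field_simp
    have : pairc (sLin a l) a = pairc l a - pairc l a * pairc a a := by
      rw [sLin_apply]
      simp [pairc, inner_sub_left, real_inner_smul_left]
    rw [this, hself, hn]
    linarith

lemma inner_sum_smul_eq {i : Fin r} {c : V} (hc : R.IsFundCoweight i c) (k : Fin r → ℕ) :
    ⟪∑ j, (k j : ℝ) • R.α j, c⟫ = k i := by
  simp [sum_inner, real_inner_smul_left, hc _]

lemma pairc_fundWeight {i : Fin r} {c ϖ : V} (hc : R.IsFundCoweight i c)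
    (hϖ : R.IsFundWeight i ϖ) {a : V} (ha : a ∈ R.pos) :
    pairc ϖ a = ⟪a, c⟫ * (⟪R.α i, R.α i⟫ / ⟪a, a⟫) := by
  obtain ⟨-, k, hk⟩ := ha
  have hα : ∀ j, ⟪ϖ, R.α j⟫ = if j = i then ⟪R.α i, R.α i⟫ / 2 else 0 := by
    intro j
    have := pairc_mul_inner_self (R.ne_zero _ (R.simple_mem j)) ϖ
    rw [hϖ j] at this
    split_ifs at this ⊢ with h
    · subst h
      linarith
    · linarith
  have h1 : ⟪ϖ, a⟫ = k i * (⟪R.α i, R.α i⟫ / 2) := by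
    simp [hk, inner_sum, real_inner_smul_right, hα]
  have h2 : ⟪a, c⟫ = k i := by rw [hk, R.inner_sum_smul_eq hc]
  rw [pairc_eq, h1, h2]
  ring

/-- The simple root at the node of a minuscule fundamental coweight is long. -/
lemma inner_self_le_of_isMinusculeCoweight {i : Fin r} {c : V} (hc : R.IsFundCoweight i c)
    (hmin : R.IsMinusculeCoweight c) {b : V} (hb : b ∈ R.roots) :
    ⟪b, b⟫ ≤ ⟪R.α i, R.α i⟫ := by
  by_contra! hlt
  have hi := R.simple_mem i
  obtain ⟨l, hl, hlb, hp⟩ := R.exists_pairc_le_neg_two hi hb hlt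
  have neg_mem : ∀ x ∈ R.roots, -x ∈ R.roots := by
    intro x hx
    have hx0 := inner_self_ne_zero (𝕜 := ℝ).2 (R.ne_zero x hx)
    have hself : pairc x x = 2 := by
      rw [pairc_eq]
      field_simp
    have h := R.reflect_mem x hx x hx
    rw [sLin_apply, hself, two_smul] at h
    simpa using h
  have hs := R.reflect_mem _ hi l hl
  have hsl := sLin_apply (R.α i) l
  have hsc : ⟪sLin (R.α i) l, c⟫ = ⟪l, c⟫ - pairc l (R.α i) := by
    rw [hsl, inner_sub_left, real_inner_smul_left, hc i, if_pos rfl, mul_one]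
  rcases R.pos_or_neg l hl with ⟨k, hk⟩ | ⟨k, hk⟩
  · have h0 : (0 : ℝ) ≤ ⟪l, c⟫ := by
      rw [hk, R.inner_sum_smul_eq hc]
      positivity
    rcases R.pos_or_neg _ hs with hd | ⟨d, hd⟩
    · rcases hmin _ ⟨hs, hd⟩ with h | h <;> linarith
    · have : ⟪sLin (R.α i) l, c⟫ ≤ (0 : ℝ) := by
        rw [hd, inner_neg_left, R.inner_sum_smul_eq hc]
        simp
      linarith
  · have hlc : ⟪l, c⟫ = -(k i : ℝ) := by rw [hk, inner_neg_left, R.inner_sum_smul_eq hc]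
    have hl1 := hmin (-l) ⟨neg_mem l hl, k, by rw [hk, neg_neg]⟩
    rw [inner_neg_left, hlc, neg_neg] at hl1
    rcases R.pos_or_neg _ hs with ⟨d, hd⟩ | ⟨d, hd⟩
    · have hsum : ∑ j, ((d j : ℝ) + k j + if j = i then pairc l (R.α i) else 0) • R.α j = 0 := by
        simp only [add_smul, Finset.sum_add_distrib, ite_smul, zero_smul, Finset.sum_ite_eq',
          Finset.mem_univ, if_true]
        rw [← hd, hsl, ← neg_eq_iff_eq_neg.2 hk]
        abel
      have hz := Fintype.linearIndependent_iff.1 R.simple_indep _ hsum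
      have hkz : ∀ j, j ≠ i → (k j : ℝ) = 0 := by
        intro j hj
        have := hz j
        rw [if_neg hj] at this
        have h1 : (0 : ℝ) ≤ d j := Nat.cast_nonneg _
        have h2 : (0 : ℝ) ≤ k j := Nat.cast_nonneg _
        linarith
      have hli : l = -((k i : ℝ) • R.α i) := by
        rw [hk, Finset.sum_eq_single i (fun j _ hj => by rw [hkz j hj, zero_smul]) (by simp)]
      have hpos := real_inner_self_pos.2 (R.ne_zero _ hi)
      rw [← hlb, hli, inner_neg_neg, real_inner_smul_left, real_inner_smul_right] at hlt
      rcases hl1 with h | h <;> rw [h] at hlt <;> linarith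
    · have hs1 := hmin (-sLin (R.α i) l) ⟨neg_mem _ hs, d, by rw [hd, neg_neg]⟩
      rw [inner_neg_left] at hs1
      rcases hl1 with h | h <;> rcases hs1 with h' | h' <;> linarith

end RootSystemBase

end

/-- **Lemma 5(ii)** (Magyar).  If `Δ` is not simply laced and the fundamental coweight
`ϖ_i∨` is minuscule for `Δ`, then the fundamental weight `ϖ_i` is minuscule for the
simply-laced root system `Δ∨_s` of short vectors of the dual root system `Δ∨`
(i.e. `⟨ϖ_i, α∨⟩ ∈ {0,1}` for every positive short coroot), and moreover the simple
coroot `α_i∨` is itself a short vector of `Δ∨`. -/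
theorem fundWeight_minuscule_short_of_not_simplyLaced
    {V : Type*} [NormedAddCommGroup V] [InnerProductSpace ℝ V] {r : ℕ}
    (R : RootSystemBase r V)
    (notSimplyLaced : ∃ a ∈ R.roots, ∃ b ∈ R.roots, ⟪a, a⟫ ≠ ⟪b, b⟫)
    (i : Fin r) (c : V) (hc : R.IsFundCoweight i c) (hmin : R.IsMinusculeCoweight c)
    (ϖ : V) (hϖ : R.IsFundWeight i ϖ) :
    (∀ a ∈ R.pos, coroot a ∈ R.shortDualRoots → pairc ϖ a = 0 ∨ pairc ϖ a = 1) ∧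
      coroot (R.α i) ∈ R.shortDualRoots := by
  have hlong : ∀ b ∈ R.roots, ⟪b, b⟫ ≤ ⟪R.α i, R.α i⟫ := fun _ =>
    R.inner_self_le_of_isMinusculeCoweight hc hmin
  refine ⟨fun a ha hshort => ?_, (R.coroot_mem_shortDualRoots_iff (R.simple_mem i)).2 hlong⟩
  have heq : ⟪R.α i, R.α i⟫ = ⟪a, a⟫ :=
    le_antisymm ((R.coroot_mem_shortDualRoots_iff ha.1).1 hshort _ (R.simple_mem i))
      (hlong a ha.1)
  rw [R.pairc_fundWeight hc hϖ ha, heq, div_self (inner_self_ne_zero.2 (R.ne_zero a ha.1)),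
    mul_one]
  exact hmin a ha

end Litt
end
end

section
/- Suppose the fundamental coweight ϖ_i∨ is minuscule. Consider on the Weyl group orbit W·ϖ_i the parabolic Bruhat order, i.e. the partial order generated by the relations τ₁ < τ₂ whenever τ₁ = τ₂ − dα for some positive root α ∈ Δ⁺ and some d > 0. Then this order coincides with the partial order generated by the relations τ₁ < τ₂ whenever τ₁ = τ₂ − dα_j for some SIMPLE root α_j and some d > 0; in particular, every covering relation τ₁ ⋖ τ₂ of the parabolic Bruhat order satisfies τ₁ = τ₂ − dα_j for a simple root α_j and some d > 0. -/
/-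
Background: reduced irreducible crystallographic root systems with a chosen base,
realized in a real inner product space.  Coweights are represented as vectors of the
same space via the `W`-invariant inner product (so the coroot of `a` is `2a/(a,a)`).
-/

open scoped RealInnerProductSpace Classical

noncomputable section

namespace Litt

namespace RootSystemBase

variable {V : Type*} [NormedAddCommGroup V] [InnerProductSpace ℝ V] {r : ℕ}
variable (R : RootSystemBase r V)

/-- One step of the parabolic Bruhat order on the orbit `W·ϖ`: `τ₁ < τ₂` whenever
`τ₁ = τ₂ - d·a` for some positive root `a` and some `d > 0`. -/
def orbitStepPos (ϖ : V) (τ₁ τ₂ : V) : Prop :=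
  τ₁ ∈ R.orbit ϖ ∧ τ₂ ∈ R.orbit ϖ ∧ ∃ a ∈ R.pos, ∃ dd : ℝ, 0 < dd ∧ τ₁ = τ₂ - dd • a

/-- The analogous step using only *simple* roots. -/
def orbitStepSimple (ϖ : V) (τ₁ τ₂ : V) : Prop :=
  τ₁ ∈ R.orbit ϖ ∧ τ₂ ∈ R.orbit ϖ ∧ ∃ j : Fin r, ∃ dd : ℝ, 0 < dd ∧ τ₁ = τ₂ - dd • R.α j

theorem sLin_apply (a x : V) : sLin a x = x - pairc x a • a := by
  simp [sLin, pairc, real_inner_comm]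

theorem pairc_eq (x a : V) : pairc x a = 2 / ⟪a, a⟫ * ⟪x, a⟫ := by
  simp [pairc, coroot, inner_smul_right]

theorem pairc_self {a : V} (ha : a ≠ 0) : pairc a a = 2 := by
  rw [pairc_eq, div_mul_cancel₀ _ (inner_self_ne_zero.2 ha)]

theorem inner_sLin_left (a x y : V) : ⟪sLin a x, y⟫ = ⟪x, sLin a y⟫ := by
  simp only [sLin_apply, pairc_eq, inner_sub_left, inner_sub_right, real_inner_smul_left,
    real_inner_smul_right, real_inner_comm a y]
  ring

theorem sLin_self {a : V} (ha : a ≠ 0) : sLin a a = -a := by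
  rw [sLin_apply, pairc_self ha]
  module

theorem sLin_sLin {a : V} (ha : a ≠ 0) (x : V) : sLin a (sLin a x) = x := by
  conv_lhs => rw [sLin_apply a x]
  rw [map_sub, map_smul, sLin_self ha, sLin_apply]
  module

/-- The reflection `s_a` as a linear automorphism. -/
def sEquiv {a : V} (ha : a ≠ 0) : V ≃ₗ[ℝ] V :=
  LinearEquiv.ofInvolutive (sLin a) (sLin_sLin ha)

/-- The inner products of `x` with the roots all lie in `{-m, 0, m}`. -/
def PairsWithin (R : RootSystemBase r V) (m : ℝ) (x : V) : Prop :=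
  ∀ a ∈ R.roots, ⟪x, a⟫ = -m ∨ ⟪x, a⟫ = 0 ∨ ⟪x, a⟫ = m

theorem simple_ne_zero (j : Fin r) : R.α j ≠ 0 := R.ne_zero _ (R.simple_mem j)

theorem simple_mem_pos (j : Fin r) : R.α j ∈ R.pos :=
  ⟨R.simple_mem j, Pi.single j 1, by simp [Pi.single_apply]⟩

theorem neg_mem_roots {a : V} (ha : a ∈ R.roots) : -a ∈ R.roots := by
  rw [← sLin_self (R.ne_zero a ha)]
  exact R.reflect_mem a ha a ha

theorem mem_pos_or_neg_mem_pos {a : V} (ha : a ∈ R.roots) : a ∈ R.pos ∨ -a ∈ R.pos := by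
  rcases R.pos_or_neg a ha with ⟨c, hc⟩ | ⟨c, hc⟩
  · exact Or.inl ⟨ha, c, hc⟩
  · exact Or.inr ⟨R.neg_mem_roots ha, c, by rw [hc, neg_neg]⟩

variable {R}

theorem sLin_mem_orbit {ϖ x : V} (hx : x ∈ R.orbit ϖ) (j : Fin r) :
    sLin (R.α j) x ∈ R.orbit ϖ := by
  obtain ⟨g, hg, rfl⟩ := hx
  exact ⟨sEquiv (R.simple_ne_zero j) * g,
    R.weyl.mul_mem (Subgroup.subset_closure ⟨j, fun _ => rfl⟩) hg, rfl⟩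

theorem PairsWithin.sLin {m : ℝ} {x : V} (hx : PairsWithin R m x) {b : V} (hb : b ∈ R.roots) :
    PairsWithin R m (sLin b x) := fun a ha => by
  rw [inner_sLin_left]
  exact hx _ (R.reflect_mem b hb a ha)

theorem pairsWithin_weyl_iff {g : V ≃ₗ[ℝ] V} (hg : g ∈ R.weyl) (m : ℝ) :
    ∀ x, PairsWithin R m (g x) ↔ PairsWithin R m x := by
  induction hg using Subgroup.closure_induction with
  | mem g hg =>
    obtain ⟨j, hj⟩ := hg
    intro x
    rw [hj]
    refine ⟨fun h => ?_, fun h => h.sLin (R.simple_mem j)⟩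
    simpa only [sLin_sLin (R.simple_ne_zero j)] using h.sLin (R.simple_mem j)
  | one => exact fun x => Iff.rfl
  | mul g h _ _ ihg ihh => exact fun x => (ihg (h x)).trans (ihh x)
  | inv g _ ih =>
    intro x
    rw [← ih, show g (g⁻¹ x) = x from g.apply_symm_apply x]

theorem inner_self_weyl {g : V ≃ₗ[ℝ] V} (hg : g ∈ R.weyl) :
    ∀ x, ⟪g x, g x⟫ = ⟪x, x⟫ := by
  induction hg using Subgroup.closure_induction with
  | mem g hg =>
    obtain ⟨j, hj⟩ := hg
    intro x
    rw [hj, inner_sLin_left, sLin_sLin (R.simple_ne_zero j)]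
  | one => exact fun x => rfl
  | mul g h _ _ ihg ihh => exact fun x => (ihg (h x)).trans (ihh x)
  | inv g _ ih =>
    intro x
    rw [← ih, show g (g⁻¹ x) = x from g.apply_symm_apply x]

theorem exists_inner_simple_pos {a : V} (ha : a ∈ R.pos) : ∃ j, 0 < ⟪a, R.α j⟫ := by
  obtain ⟨har, c, hc⟩ := ha
  by_contra! h
  have h1 : ⟪a, a⟫ = ∑ j, (c j : ℝ) * ⟪a, R.α j⟫ := by
    conv_lhs => rw [hc, inner_sum, ← hc]
    simp only [real_inner_smul_right]
  have h2 : ⟪a, a⟫ ≤ 0 := h1.trans_le <|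
    Finset.sum_nonpos fun j _ => mul_nonpos_of_nonneg_of_nonpos (Nat.cast_nonneg _) (h j)
  exact R.ne_zero a har (real_inner_self_nonpos.1 h2)

/-- A simple reflection that lowers a positive root either negates the root, in which
case it is the simple root itself, or gives a positive root of smaller height. -/
theorem eq_simple_or_sLin_lower {c : Fin r → ℕ} {j : Fin r}
    (har : ∑ l, (c l : ℝ) • R.α l ∈ R.roots)
    (hj : 0 < ⟪∑ l, (c l : ℝ) • R.α l, R.α j⟫) :
    ∑ l, (c l : ℝ) • R.α l = R.α j ∨
      ∃ c' : Fin r → ℕ, sLin (R.α j) (∑ l, (c l : ℝ) • R.α l) = ∑ l, (c' l : ℝ) • R.α l ∧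
        ∑ l, c' l < ∑ l, c l := by
  set a := ∑ l, (c l : ℝ) • R.α l with ha
  have hk : 0 < pairc a (R.α j) := by
    rw [pairc_eq]
    exact mul_pos (div_pos two_pos (real_inner_self_pos.2 (R.simple_ne_zero j))) hj
  have coeff_eq : ∀ e : Fin r → ℝ, sLin (R.α j) a = ∑ l, e l • R.α l →
      ∀ l, e l = c l - if l = j then pairc a (R.α j) else 0 := by
    intro e he
    refine congrFun (R.simple_indep.fintypeLinearCombination_injective ?_)
    simp only [Fintype.linearCombination_apply, sub_smul, Finset.sum_sub_distrib, ite_smul,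
      zero_smul, Finset.sum_ite_eq', Finset.mem_univ, if_true]
    rw [← he, ← ha, sLin_apply]
  rcases R.pos_or_neg _ (R.reflect_mem _ (R.simple_mem j) a har) with ⟨c', hc'⟩ | ⟨c', hc'⟩
  · refine Or.inr ⟨c', hc', ?_⟩
    have h := coeff_eq (fun l => c' l) hc'
    have hsum : (∑ l, (c' l : ℝ)) = ∑ l, (c l : ℝ) - pairc a (R.α j) := by
      simp [Finset.sum_congr rfl fun l _ => h l, Finset.sum_sub_distrib]
    have : ((∑ l, c' l : ℕ) : ℝ) < (∑ l, c l : ℕ) := by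
      push_cast
      linarith
    exact_mod_cast this
  · left
    have h := coeff_eq (fun l => -(c' l : ℝ)) (by simpa using hc')
    have hzero : ∀ l, l ≠ j → (c l : ℝ) = 0 := by
      intro l hl
      have := h l
      simp only [if_neg hl, sub_zero] at this
      have h1 : (0 : ℝ) ≤ c' l := Nat.cast_nonneg _
      have h2 : (0 : ℝ) ≤ c l := Nat.cast_nonneg _
      linarith
    have haj : a = (c j : ℝ) • R.α j :=
      Finset.sum_eq_single j (fun l _ hl => by rw [hzero l hl, zero_smul]) (by simp)
    rcases R.reduced _ (R.simple_mem j) _ (haj ▸ har) with h1 | h1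
    · rw [haj, h1, one_smul]
    · have : (0 : ℝ) ≤ c j := Nat.cast_nonneg _
      linarith

theorem reflTransGen_sLin {ϖ x : V} (hx : x ∈ R.orbit ϖ) {j : Fin r} (h : 0 ≤ ⟪x, R.α j⟫) :
    Relation.ReflTransGen (R.orbitStepSimple ϖ) (sLin (R.α j) x) x := by
  have hp : 0 ≤ pairc x (R.α j) := by
    rw [pairc_eq]
    exact mul_nonneg (div_nonneg zero_le_two real_inner_self_nonneg) h
  rcases hp.eq_or_lt with h0 | h0
  · rw [sLin_apply, ← h0, zero_smul, sub_zero]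
  · exact .single ⟨sLin_mem_orbit hx j, hx, j, _, h0, sLin_apply _ _⟩

theorem transGen_simple_of_sub_smul {ϖ : V} {m : ℝ} (hm : 0 < m)
    (hP : ∀ x ∈ R.orbit ϖ, PairsWithin R m x)
    (hN : ∀ x ∈ R.orbit ϖ, ⟪x, x⟫ = ⟪ϖ, ϖ⟫) {d : ℝ} (hd : 0 < d) (n : ℕ) :
    ∀ c : Fin r → ℕ, ∑ l, c l = n → ∑ l, (c l : ℝ) • R.α l ∈ R.roots →
      ∀ x ∈ R.orbit ϖ, ∀ y ∈ R.orbit ϖ, y = x - d • ∑ l, (c l : ℝ) • R.α l →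
        Relation.TransGen (R.orbitStepSimple ϖ) y x := by
  induction n using Nat.strong_induction_on with
  | _ n ih =>
  intro c hcn har x hx y hy hxy
  obtain ⟨j, hj⟩ := exists_inner_simple_pos ⟨har, c, rfl⟩
  rcases eq_simple_or_sLin_lower har hj with hs | ⟨c', hc', hlt⟩
  · exact .single ⟨hy, hx, j, d, hd, hs ▸ hxy⟩
  have hbr := R.reflect_mem _ (R.simple_mem j) _ har
  set a := ∑ l, (c l : ℝ) • R.α l
  have haa : 0 < ⟪a, a⟫ := real_inner_self_pos.2 (R.ne_zero a har)
  have hya : ⟪y, a⟫ = ⟪x, a⟫ - d * ⟪a, a⟫ := by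
    rw [hxy, inner_sub_left, real_inner_smul_left]
  have hnorm : d * ⟪a, a⟫ = 2 * ⟪x, a⟫ := by
    have h1 : ⟪y, y⟫ = ⟪x, x⟫ := (hN y hy).trans (hN x hx).symm
    rw [hxy, inner_sub_left, inner_sub_right, inner_sub_right, real_inner_smul_left,
      real_inner_smul_left, real_inner_smul_right, real_inner_smul_right,
      real_inner_comm x a] at h1
    have h2 : d * (d * ⟪a, a⟫) = d * (2 * ⟪x, a⟫) := by linarith
    exact mul_left_cancel₀ hd.ne' h2
  have hpos : 0 < ⟪x, a⟫ := by linarith [mul_pos hd haa]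
  have hxa : ⟪x, a⟫ = m := by
    rcases hP x hx a har with h | h | h <;> linarith
  have hk : 0 < pairc a (R.α j) := by
    rw [pairc_eq]
    exact mul_pos (div_pos two_pos (real_inner_self_pos.2 (R.simple_ne_zero j))) hj
  have hb : ∀ z : V, ⟪z, sLin (R.α j) a⟫ = ⟪z, a⟫ - pairc a (R.α j) * ⟪z, R.α j⟫ := fun z => by
    rw [sLin_apply, inner_sub_right, real_inner_smul_right]
  have hxj : 0 ≤ ⟪x, R.α j⟫ := by
    by_contra! hneg
    have h1 := mul_neg_of_pos_of_neg hk hneg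
    have h2 := hb x
    rcases hP x hx _ hbr with h | h | h <;> linarith
  have hyj : ⟪y, R.α j⟫ ≤ 0 := by
    by_contra! hgt
    have h1 := mul_pos hk hgt
    have h2 := hb y
    rcases hP y hy _ hbr with h | h | h <;> linarith
  have hjy : 0 ≤ ⟪sLin (R.α j) y, R.α j⟫ := by
    rw [inner_sLin_left, sLin_self (R.simple_ne_zero j), inner_neg_right]
    linarith
  have hmid : Relation.TransGen (R.orbitStepSimple ϖ) (sLin (R.α j) y) (sLin (R.α j) x) :=
    ih _ (hcn ▸ hlt) c' rfl (hc' ▸ hbr) _ (sLin_mem_orbit hx j) _ (sLin_mem_orbit hy j)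
      (by rw [hxy, map_sub, map_smul, hc'])
  have hfirst := reflTransGen_sLin (sLin_mem_orbit hy j) hjy
  rw [sLin_sLin (R.simple_ne_zero j)] at hfirst
  exact (Relation.TransGen.trans_right hfirst hmid).trans_left (reflTransGen_sLin hx hxj)

theorem pairsWithin_fundWeight {i : Fin r} {c : V} (hc : R.IsFundCoweight i c)
    (hmin : R.IsMinusculeCoweight c) {ϖ : V} (hϖ : R.IsFundWeight i ϖ) :
    PairsWithin R (⟪R.α i, R.α i⟫ / 2) ϖ := by
  have hsimple : ∀ j, ⟪ϖ, R.α j⟫ = ⟪R.α i, R.α i⟫ / 2 * ⟪R.α j, c⟫ := by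
    intro j
    have hne : ⟪R.α j, R.α j⟫ ≠ 0 := inner_self_ne_zero.2 (R.simple_ne_zero j)
    have h1 := hϖ j
    rw [pairc_eq] at h1
    rw [hc j]
    split_ifs at h1 ⊢ with hji
    · subst hji
      field_simp at h1 ⊢
      linarith
    · simpa [R.simple_ne_zero j] using h1
  have hpos : ∀ a ∈ R.pos, ⟪ϖ, a⟫ = ⟪R.α i, R.α i⟫ / 2 * ⟪a, c⟫ := by
    rintro a ⟨-, e, rfl⟩
    rw [inner_sum, sum_inner, Finset.mul_sum]
    refine Finset.sum_congr rfl fun j _ => ?_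
    rw [real_inner_smul_right, real_inner_smul_left, hsimple]
    ring
  intro a ha
  rcases R.mem_pos_or_neg_mem_pos ha with h | h
  · rcases hmin a h with h1 | h1 <;> simp [hpos a h, h1]
  · have h2 := hpos _ h
    rw [inner_neg_right] at h2
    rcases hmin _ h with h1 | h1 <;> rw [h1] at h2
    · exact Or.inr (Or.inl (by linarith))
    · exact Or.inl (by linarith)

theorem transGen_pos_iff_transGen_simple {i : Fin r} {c : V} (hc : R.IsFundCoweight i c)
    (hmin : R.IsMinusculeCoweight c) {ϖ : V} (hϖ : R.IsFundWeight i ϖ) (τ₁ τ₂ : V) :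
    Relation.TransGen (R.orbitStepPos ϖ) τ₁ τ₂ ↔
      Relation.TransGen (R.orbitStepSimple ϖ) τ₁ τ₂ := by
  constructor
  · intro h
    induction h using Relation.TransGen.trans_induction_on with
    | trans _ _ h₁ h₂ => exact h₁.trans h₂
    | @single y x h =>
      obtain ⟨hy, hx, a, ⟨har, e, rfl⟩, d, hd, hxy⟩ := h
      refine transGen_simple_of_sub_smul (m := ⟪R.α i, R.α i⟫ / 2)
        (half_pos (real_inner_self_pos.2 (R.simple_ne_zero i))) ?_ ?_ hd _ e rfl har x hx y hy hxy
      · rintro _ ⟨g, hg, rfl⟩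
        exact (pairsWithin_weyl_iff hg _ ϖ).2 (pairsWithin_fundWeight hc hmin hϖ)
      · rintro _ ⟨g, hg, rfl⟩
        exact inner_self_weyl hg ϖ
  · refine fun h => Relation.TransGen.mono ?_ _ _ h
    rintro y x ⟨hy, hx, j, d, hd, hxy⟩
    exact ⟨hy, hx, _, R.simple_mem_pos j, d, hd, hxy⟩

end RootSystemBase

/-- **Lemma 6** (Stembridge; see Magyar, Sec. 2.2).  If the fundamental coweight
`ϖ_i∨` is minuscule, then on the orbit `W·ϖ_i` the parabolic Bruhat order (generated
by `τ₁ < τ₂` whenever `τ₁ = τ₂ - d·a`, `a ∈ Δ⁺`, `d > 0`) coincides with the order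
generated by the analogous relations along *simple* roots only; in particular every
covering relation `τ₁ ⋖ τ₂` is of the form `τ₁ = τ₂ - d·α_j` for a simple root `α_j`
and some `d > 0`. -/
theorem bruhat_order_on_minuscule_orbit
    {V : Type*} [NormedAddCommGroup V] [InnerProductSpace ℝ V] {r : ℕ}
    (R : RootSystemBase r V)
    (i : Fin r) (c : V) (hc : R.IsFundCoweight i c) (hmin : R.IsMinusculeCoweight c)
    (ϖ : V) (hϖ : R.IsFundWeight i ϖ) :
    (∀ τ₁ τ₂ : V,
      Relation.TransGen (R.orbitStepPos ϖ) τ₁ τ₂ ↔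
      Relation.TransGen (R.orbitStepSimple ϖ) τ₁ τ₂) ∧
    (∀ τ₁ τ₂ : V,
      Relation.TransGen (R.orbitStepPos ϖ) τ₁ τ₂ →
      (¬ ∃ τ, Relation.TransGen (R.orbitStepPos ϖ) τ₁ τ ∧
              Relation.TransGen (R.orbitStepPos ϖ) τ τ₂) →
      ∃ j : Fin r, ∃ dd : ℝ, 0 < dd ∧ τ₁ = τ₂ - dd • R.α j) := by
  have key := RootSystemBase.transGen_pos_iff_transGen_simple hc hmin hϖ
  refine ⟨key, fun τ₁ τ₂ h hcov => ?_⟩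
  cases (key _ _).1 h with
  | single h =>
    obtain ⟨-, -, hstep⟩ := h
    exact hstep
  | tail h₁ h₂ => exact (hcov ⟨_, (key _ _).2 h₁, (key _ _).2 (.single h₂)⟩).elim

end Litt
end
end
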